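/- For every display sequent δ and all labels w, u: (1) L_w(δ) is a labeled polytree sequent; (2) the length of L_w(δ) is at most the length of δ; (3) L_w(δ) and L_u(δ) are isomorphic labeled sequents. -/

import Mathlib

set_option linter.unusedVariables false

/-- Formulae of the tense language `L`. -/
inductive Fm : Type where
  | atom : Nat → Fm
  | top : Fm
  | bot : Fm
  | neg : Fm → Fm
  | or : Fm → Fm → Fm
  | and : Fm → Fm → Fm
  | imp : Fm → Fm → Fm
  | box : Fm → Fm
  | dia : Fm → Fm
  | boxP : Fm → Fm
  | diaP : Fm → Fm
deriving DecidableEq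

instance : Inhabited Fm := ⟨Fm.top⟩

/-- Display structures `X ::= A | I | *X | •X | (X∘X)`. -/
inductive Str : Type where
  | fm : Fm → Str
  | I : Str
  | star : Str → Str
  | bullet : Str → Str
  | comp : Str → Str → Str
deriving DecidableEq

/-- Display sequents `X ⊢ Y`. -/
structure DSeq : Type where
  ant : Str
  suc : Str
deriving DecidableEq

/-- Length of a structure. -/
def Str.len : Str → Nat
  | .fm _ => 1
  | .I => 1
  | .star X => X.len + 1
  | .bullet X => X.len + 1
  | .comp X Y => X.len + Y.len + 1

/-- Length of a display sequent. -/
def DSeq.len (d : DSeq) : Nat := d.ant.len + d.suc.len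

/-- The translation `ψ` from formulae of `L_{∧,◇,♦}` to (schematic) structures, where the
structure variable `Ẋ_p` for each atom `p` is instantiated by `θ p`. -/
def psiStr (θ : Nat → Str) : Fm → Str
  | .atom p => θ p
  | .top => .I
  | .and A B => .comp (psiStr θ A) (psiStr θ B)
  | .dia A => .star (.bullet (.star (psiStr θ A)))
  | .diaP A => .bullet (psiStr θ A)
  | _ => .I

/-- Labeled sequents `R, Γ ⇒ Δ`: a set of relational atoms together with multisets of
labeled formulae on the left and on the right. -/
structure LSeq : Type where
  rel : Finset (Nat × Nat)
  ant : Multiset (Nat × Fm)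
  suc : Multiset (Nat × Fm)

/-- The empty labeled sequent. -/
def LSeq.empty : LSeq := ⟨∅, 0, 0⟩
instance : Inhabited LSeq := ⟨LSeq.empty⟩

/-- Sequent composition `⊗`. -/
def LSeq.comp (s t : LSeq) : LSeq := ⟨s.rel ∪ t.rel, s.ant + t.ant, s.suc + t.suc⟩

/-- The labeled sequent `w : A ⇒ ∅`. -/
def Fq (w : Nat) (A : Fm) : LSeq := ⟨∅, {(w, A)}, 0⟩
/-- The labeled sequent `∅ ⇒ w : A`. -/
def Gq (w : Nat) (A : Fm) : LSeq := ⟨∅, 0, {(w, A)}⟩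
/-- The labeled sequent `Rwu ⇒ ∅`. -/
def Rl (w u : Nat) : LSeq := ⟨{(w, u)}, 0, 0⟩

/-- The labels occurring in a labeled sequent. -/
def LSeq.labels (s : LSeq) : Finset Nat :=
  s.rel.image Prod.fst ∪ s.rel.image Prod.snd ∪
    (s.ant.map Prod.fst).toFinset ∪ (s.suc.map Prod.fst).toFinset

/-- The length `|R| + |Γ| + |Δ|` of a labeled sequent. -/
def LSeq.len (s : LSeq) : Nat := s.rel.card + Multiset.card s.ant + Multiset.card s.suc

/-- Applying a label substitution to a labeled sequent. -/
def LSeq.rename (f : Nat → Nat) (s : LSeq) : LSeq :=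
  ⟨s.rel.image (fun e => (f e.1, f e.2)),
   s.ant.map (fun x => (f x.1, x.2)),
   s.suc.map (fun x => (f x.1, x.2))⟩

/-- The (undirected simple) graph of a labeled sequent: labels as vertices, and an edge
between `a` and `b` for each relational atom `Rab`. -/
def LSeq.graph (s : LSeq) : SimpleGraph Nat :=
  SimpleGraph.fromRel (fun a b => (a, b) ∈ s.rel)

/-- `s` is a labeled polytree sequent: (1) if `R = ∅` then `s` is `w`-flat for some `w`;
(2) if `R ≠ ∅` then every label of `Γ, Δ` occurs in `R`; (3) the graph of `s` is connected
and free of directed and undirected cycles. -/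
def IsPolytree (s : LSeq) : Prop :=
  (s.rel = ∅ → ∃ w, (∀ x ∈ s.ant, x.1 = w) ∧ (∀ x ∈ s.suc, x.1 = w)) ∧
  (s.rel ≠ ∅ →
    (∀ x ∈ s.ant, x.1 ∈ s.rel.image Prod.fst ∪ s.rel.image Prod.snd) ∧
    (∀ x ∈ s.suc, x.1 ∈ s.rel.image Prod.fst ∪ s.rel.image Prod.snd)) ∧
  (∀ a, (a, a) ∉ s.rel) ∧
  (∀ a b, (a, b) ∈ s.rel → (b, a) ∉ s.rel) ∧
  s.graph.IsAcyclic ∧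
  (∀ a ∈ s.labels, ∀ b ∈ s.labels, s.graph.Reachable a b)

/-- Isomorphism of labeled sequents: a bijection between the label sets preserving and
reflecting relational atoms and labeled formulae on each side. -/
def LSeq.Iso (s t : LSeq) : Prop :=
  ∃ f : Nat → Nat, Set.BijOn f ↑s.labels ↑t.labels ∧
    (∀ a b, (a, b) ∈ s.rel → (f a, f b) ∈ t.rel) ∧
    (∀ a b, a ∈ s.labels → b ∈ s.labels → (f a, f b) ∈ t.rel → (a, b) ∈ s.rel) ∧
    (∀ a A, (a, A) ∈ s.ant → (f a, A) ∈ t.ant) ∧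
    (∀ a A, a ∈ s.labels → (f a, A) ∈ t.ant → (a, A) ∈ s.ant) ∧
    (∀ a A, (a, A) ∈ s.suc → (f a, A) ∈ t.suc) ∧
    (∀ a A, a ∈ s.labels → (f a, A) ∈ t.suc → (a, A) ∈ s.suc)

/-- The translations `L^w_1` (for `b = true`) and `L^w_2` (for `b = false`) from display
structures to labeled sequents, with root label `w`; the counter `c` supplies fresh
labels. -/
def Lt (b : Bool) : Str → Nat → Nat → LSeq × Nat
  | .fm A, w, c => (if b then Fq w A else Gq w A, c)
  | .I, _, c => (LSeq.empty, c)
  | .star X, w, c => Lt (!b) X w c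
  | .bullet X, w, c =>
      let r := Lt b X c (c + 1)
      ((if b then Rl c w else Rl w c).comp r.1, r.2)
  | .comp X Y, w, c =>
      let r := Lt b X w c
      let t := Lt b Y w r.2
      (r.1.comp t.1, t.2)

/-- The translation `L_w` of display sequents to labeled sequents:
`L_w(X ⊢ Y) = L^w_1(X) ⊗ L^w_2(Y)`. -/
def Ltrans (d : DSeq) (w : Nat) : LSeq :=
  let r := Lt true d.ant w (w + 1)
  r.1.comp (Lt false d.suc w r.2).1

theorem SimpleGraph.isAcyclic_of_unique_smaller_neighbor {V : Type*} [LinearOrder V]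
    (G : SimpleGraph V)
    (h : ∀ n m m', G.Adj n m → G.Adj n m' → m < n → m' < n → m = m') : G.IsAcyclic := by
  intro v p hp
  obtain ⟨u, hu, hmax⟩ := p.support.toFinset.exists_max_image id ⟨v, by simp⟩
  have hu' : u ∈ p.support := by simpa using hu
  have hq := hp.rotate hu'
  have hle : ∀ x ∈ (p.rotate u hu').support, x ≤ u := fun x hx =>
    hmax x (by simpa using (p.mem_support_rotate_iff u hu').1 hx)
  have h1 := (p.rotate u hu').adj_snd hq.not_nil
  have h2 := ((p.rotate u hu').adj_penultimate hq.not_nil).symm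
  exact hq.snd_ne_penultimate (h u _ _ h1 h2
    (lt_of_le_of_ne (hle _ (SimpleGraph.Walk.getVert_mem_support _ _)) h1.ne')
    (lt_of_le_of_ne (hle _ (SimpleGraph.Walk.getVert_mem_support _ _)) h2.ne'))

namespace LSeq

/-- The labels occurring in relational atoms. -/
def relLabels (s : LSeq) : Finset Nat := s.rel.image Prod.fst ∪ s.rel.image Prod.snd

theorem mem_relLabels {s : LSeq} {a : Nat} :
    a ∈ s.relLabels ↔ ∃ b, (a, b) ∈ s.rel ∨ (b, a) ∈ s.rel := by
  simp [relLabels, exists_or]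

theorem mem_labels {s : LSeq} {a : Nat} :
    a ∈ s.labels ↔ a ∈ s.relLabels ∨ (∃ A, (a, A) ∈ s.ant) ∨ ∃ A, (a, A) ∈ s.suc := by
  simp [relLabels, labels, or_assoc]

theorem relLabels_comp (s t : LSeq) : (s.comp t).relLabels = s.relLabels ∪ t.relLabels := by
  ext a; simp only [mem_relLabels, comp, Finset.mem_union]; grind

theorem graph_adj {s : LSeq} {a b : Nat} :
    s.graph.Adj a b ↔ a ≠ b ∧ ((a, b) ∈ s.rel ∨ (b, a) ∈ s.rel) := by
  simp [graph]

theorem graph_comp (s t : LSeq) : (s.comp t).graph = s.graph ⊔ t.graph := by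
  ext a b; simp only [graph_adj, SimpleGraph.sup_adj, comp, Finset.mem_union]; tauto

theorem len_comp_le (s t : LSeq) : (s.comp t).len ≤ s.len + t.len := by
  have := Finset.card_union_le s.rel t.rel
  simp only [len, comp, Multiset.card_add]; omega

theorem rename_comp (f : Nat → Nat) (s t : LSeq) :
    (s.comp t).rename f = (s.rename f).comp (t.rename f) := by
  simp [rename, comp, Finset.image_union]

theorem rename_rename (f g : Nat → Nat) (s : LSeq) :
    (s.rename g).rename f = s.rename (f ∘ g) := by
  simp [rename, Finset.image_image, Function.comp_def]

theorem labels_rename (f : Nat → Nat) (s : LSeq) :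
    (s.rename f).labels = s.labels.image f := by
  ext a
  simp only [mem_labels, mem_relLabels, rename, Finset.mem_image, Multiset.mem_map, Prod.exists,
    Prod.mk.injEq]
  grind

theorem iso_rename {f : Nat → Nat} {s : LSeq} (hf : Set.InjOn f s.labels) :
    s.Iso (s.rename f) := by
  have hrel {a b} (h : (a, b) ∈ s.rel) : a ∈ s.labels ∧ b ∈ s.labels := by
    simp only [mem_labels, mem_relLabels]; grind
  have hant {a A} (h : (a, A) ∈ s.ant) : a ∈ s.labels := mem_labels.2 (.inr (.inl ⟨A, h⟩))
  have hsuc {a A} (h : (a, A) ∈ s.suc) : a ∈ s.labels := mem_labels.2 (.inr (.inr ⟨A, h⟩))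
  refine ⟨f, ?_, ?_, ?_, ?_, ?_, ?_, ?_⟩
  · rw [labels_rename, Finset.coe_image]
    exact hf.bijOn_image
  · exact fun a b h => Finset.mem_image_of_mem (fun e : Nat × Nat => (f e.1, f e.2)) h
  · intro a b ha hb h
    obtain ⟨⟨x, y⟩, hxy, he⟩ := Finset.mem_image.1 h
    obtain ⟨h1, h2⟩ := Prod.mk.inj he
    rwa [← hf (hrel hxy).1 ha h1, ← hf (hrel hxy).2 hb h2]
  · exact fun a A h => Multiset.mem_map_of_mem (fun x : Nat × Fm => (f x.1, x.2)) h
  · intro a A ha h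
    obtain ⟨⟨x, B⟩, hx, he⟩ := Multiset.mem_map.1 h
    obtain ⟨h1, rfl⟩ := Prod.mk.inj he
    rwa [← hf (hant hx) ha h1]
  · exact fun a A h => Multiset.mem_map_of_mem (fun x : Nat × Fm => (f x.1, x.2)) h
  · intro a A ha h
    obtain ⟨⟨x, B⟩, hx, he⟩ := Multiset.mem_map.1 h
    obtain ⟨h1, rfl⟩ := Prod.mk.inj he
    rwa [← hf (hsuc hx) ha h1]

/-- `s` is a polytree rooted at `w` whose other labels lie in `[c, c')`, where the root is the
least label and every label has at most one smaller neighbour. -/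
structure IsRootedTree (s : LSeq) (w c c' : Nat) : Prop where
  le : c ≤ c'
  edge : ∀ a b, (a, b) ∈ s.rel →
    (a < b ∧ c ≤ b ∧ b < c' ∧ (a = w ∨ c ≤ a)) ∨ (b < a ∧ c ≤ a ∧ a < c' ∧ (b = w ∨ c ≤ b))
  asymm : ∀ a b, (a, b) ∈ s.rel → (b, a) ∉ s.rel
  parent_unique : ∀ n m m', ((n, m) ∈ s.rel ∨ (m, n) ∈ s.rel) →
    ((n, m') ∈ s.rel ∨ (m', n) ∈ s.rel) → m < n → m' < n → m = m'
  root_mem : s.rel ≠ ∅ → w ∈ s.relLabels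
  label_ant : ∀ x ∈ s.ant, x.1 = w ∨ x.1 ∈ s.relLabels
  label_suc : ∀ x ∈ s.suc, x.1 = w ∨ x.1 ∈ s.relLabels
  reachable : ∀ a ∈ s.relLabels, s.graph.Reachable w a

namespace IsRootedTree

theorem of_rel_eq_empty {s : LSeq} {w c : Nat} (h : s.rel = ∅)
    (ha : ∀ x ∈ s.ant, x.1 = w) (hs : ∀ x ∈ s.suc, x.1 = w) : s.IsRootedTree w c c := by
  refine ⟨le_rfl, ?_, ?_, ?_, ?_, fun x hx => .inl (ha x hx), fun x hx => .inl (hs x hx), ?_⟩ <;>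
    simp [mem_relLabels, h]

theorem comp {s t : LSeq} {w c c' c'' : Nat} (hw : w < c) (hs : s.IsRootedTree w c c')
    (ht : t.IsRootedTree w c' c'') : (s.comp t).IsRootedTree w c c'' := by
  have h1 := hs.le
  have h2 := ht.le
  have hse := hs.edge
  have hte := ht.edge
  refine ⟨h1.trans h2, ?_, ?_, ?_, ?_, ?_, ?_, ?_⟩
  · intro a b h
    rcases Finset.mem_union.1 h with h | h
    · have := hse a b h; omega
    · have := hte a b h; omega
  · intro a b h h'
    rcases Finset.mem_union.1 h with h | h <;> rcases Finset.mem_union.1 h' with h' | h'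
    · exact hs.asymm a b h h'
    · have := hse a b h; have := hte b a h'; omega
    · have := hte a b h; have := hse b a h'; omega
    · exact ht.asymm a b h h'
  · have key : ∀ n m m', ((n, m) ∈ s.rel ∨ (m, n) ∈ s.rel) →
        ((n, m') ∈ t.rel ∨ (m', n) ∈ t.rel) → m < n → m' < n → False := by
      intro n m m' h h' hm hm'
      have := hse n m; have := hse m n; have := hte n m'; have := hte m' n
      rcases h with h | h <;> rcases h' with h' | h' <;> simp only [h, h', true_imp_iff] at * <;>
        omega
    have hsp := hs.parent_unique
    have htp := ht.parent_unique
    simp only [LSeq.comp, Finset.mem_union]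
    grind
  · intro h
    rw [relLabels_comp, Finset.mem_union]
    by_cases he : s.rel = ∅
    · exact .inr (ht.root_mem fun h' => h (by simp [LSeq.comp, he, h']))
    · exact .inl (hs.root_mem he)
  · intro x hx
    rw [relLabels_comp, Finset.mem_union]
    rcases Multiset.mem_add.1 hx with hx | hx
    · have := hs.label_ant x hx; tauto
    · have := ht.label_ant x hx; tauto
  · intro x hx
    rw [relLabels_comp, Finset.mem_union]
    rcases Multiset.mem_add.1 hx with hx | hx
    · have := hs.label_suc x hx; tauto
    · have := ht.label_suc x hx; tauto
  · intro a ha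
    rw [graph_comp]
    rw [relLabels_comp, Finset.mem_union] at ha
    rcases ha with ha | ha
    · exact (hs.reachable a ha).mono le_sup_left
    · exact (ht.reachable a ha).mono le_sup_right

theorem addRoot {s : LSeq} {w c c' : Nat} {e : Nat × Nat} (hw : w < c)
    (hs : s.IsRootedTree c (c + 1) c') (he : e = (c, w) ∨ e = (w, c)) :
    ((Rl e.1 e.2).comp s).IsRootedTree w c c' := by
  have h1 := hs.le
  have hse := hs.edge
  have hmem : ∀ a b, (a, b) ∈ ((Rl e.1 e.2).comp s).rel ↔ (a, b) = e ∨ (a, b) ∈ s.rel := by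
    intro a b; simp [LSeq.comp, Rl]
  have hlab : ∀ a, a ∈ ((Rl e.1 e.2).comp s).relLabels ↔ a = w ∨ a = c ∨ a ∈ s.relLabels := by
    intro a
    rw [relLabels_comp, Finset.mem_union]
    rcases he with rfl | rfl <;> simp [relLabels, Rl] <;> tauto
  refine ⟨by omega, ?_, ?_, ?_, ?_, ?_, ?_, ?_⟩
  · intro a b h
    rcases (hmem a b).1 h with h | h
    · grind
    · have := hse a b h; omega
  · intro a b h h'
    have := hs.asymm a b
    rw [hmem] at h h'
    grind
  · have hsp := hs.parent_unique
    simp only [hmem]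
    grind
  · exact fun _ => (hlab w).2 (.inl rfl)
  · intro x hx
    have := hs.label_ant x (by simpa [LSeq.comp, Rl] using hx)
    rw [hlab]; tauto
  · intro x hx
    have := hs.label_suc x (by simpa [LSeq.comp, Rl] using hx)
    rw [hlab]; tauto
  · intro a ha
    have hwc : ((Rl e.1 e.2).comp s).graph.Reachable w c := by
      refine SimpleGraph.Adj.reachable (graph_adj.2 ⟨hw.ne, ?_⟩)
      rw [hmem, hmem]; grind
    rcases (hlab a).1 ha with rfl | rfl | ha
    · exact .refl _
    · exact hwc
    · exact hwc.trans ((hs.reachable a ha).mono (by rw [graph_comp]; exact le_sup_right))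

theorem isPolytree {s : LSeq} {w c c' : Nat} (hs : s.IsRootedTree w c c') : IsPolytree s := by
  have hw : ∀ x, (x = w ∨ x ∈ s.relLabels) → s.rel ≠ ∅ → x ∈ s.relLabels := by
    rintro x (rfl | h) h'
    exacts [hs.root_mem h', h]
  refine ⟨fun h => ⟨w, ?_, ?_⟩, fun h => ⟨?_, ?_⟩, ?_, hs.asymm, ?_, ?_⟩
  · intro x hx
    simpa [mem_relLabels, h] using hs.label_ant x hx
  · intro x hx
    simpa [mem_relLabels, h] using hs.label_suc x hx
  · exact fun x hx => hw _ (hs.label_ant x hx) h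
  · exact fun x hx => hw _ (hs.label_suc x hx) h
  · exact fun a h => hs.asymm a a h h
  · refine SimpleGraph.isAcyclic_of_unique_smaller_neighbor _ fun n m m' h h' => ?_
    exact hs.parent_unique n m m' (graph_adj.1 h).2 (graph_adj.1 h').2
  · have key : ∀ a ∈ s.labels, s.graph.Reachable w a := by
      intro a ha
      have : a = w ∨ a ∈ s.relLabels := by
        rcases mem_labels.1 ha with h | ⟨A, h⟩ | ⟨A, h⟩
        exacts [.inr h, hs.label_ant _ h, hs.label_suc _ h]
      rcases this with rfl | h
      exacts [.refl _, hs.reachable a h]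
    exact fun a ha b hb => (key a ha).symm.trans (key b hb)

end IsRootedTree

end LSeq

theorem Lt_isRootedTree (X : Str) : ∀ (b : Bool) (w c : Nat), w < c →
    (Lt b X w c).1.IsRootedTree w c (Lt b X w c).2 := by
  induction X with
  | fm A =>
    intro b w c _
    cases b <;> exact .of_rel_eq_empty rfl (by simp [Lt, Fq, Gq]) (by simp [Lt, Fq, Gq])
  | I =>
    intro b w c _
    exact .of_rel_eq_empty rfl (by simp [Lt, LSeq.empty]) (by simp [Lt, LSeq.empty])
  | star X ih => exact fun b => ih (!b)
  | bullet X ih =>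
    intro b w c hw
    have h := ih b c (c + 1) c.lt_succ_self
    cases b
    exacts [h.addRoot hw (e := (w, c)) (.inr rfl), h.addRoot hw (e := (c, w)) (.inl rfl)]
  | comp X Y ihX ihY =>
    intro b w c hw
    have h := ihX b w c hw
    exact h.comp hw (ihY b w _ (hw.trans_le h.le))

theorem Lt_len_le (X : Str) : ∀ (b : Bool) (w c : Nat), (Lt b X w c).1.len ≤ X.len := by
  induction X with
  | fm A => intro b w c; cases b <;> simp [Lt, Fq, Gq, LSeq.len, Str.len]
  | I => intro b w c; simp [Lt, LSeq.empty, LSeq.len, Str.len]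
  | star X ih => exact fun b w c => (ih (!b) w c).trans (Nat.le_succ _)
  | bullet X ih =>
    intro b w c
    have h := ih b c (c + 1)
    refine (LSeq.len_comp_le _ _).trans ?_
    have : (if b then Rl c w else Rl w c).len = 1 := by cases b <;> simp [Rl, LSeq.len]
    rw [this, Str.len]
    omega
  | comp X Y ihX ihY =>
    intro b w c
    refine (LSeq.len_comp_le _ _).trans ?_
    have h1 := ihX b w c
    have h2 := ihY b w (Lt b X w c).2
    rw [Str.len]
    omega

theorem Lt_add (X : Str) (k : Nat) : ∀ (b : Bool) (w c : Nat),
    Lt b X (w + k) (c + k) = ((Lt b X w c).1.rename (· + k), (Lt b X w c).2 + k) := by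
  induction X with
  | fm A => intro b w c; cases b <;> simp [Lt, Fq, Gq, LSeq.rename]
  | I => intro b w c; simp [Lt, LSeq.empty, LSeq.rename]
  | star X ih => exact fun b => ih (!b)
  | bullet X ih =>
    intro b w c
    have h := ih b c (c + 1)
    rw [Nat.add_right_comm] at h
    simp only [Lt, h, LSeq.rename_comp]
    cases b <;> simp [Rl, LSeq.rename]
  | comp X Y ihX ihY =>
    intro b w c
    simp only [Lt, ihX, ihY, LSeq.rename_comp]

theorem Ltrans_eq_rename (d : DSeq) (w : Nat) :
    Ltrans d w = (Ltrans d 0).rename (· + w) := by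
  have h1 := Lt_add d.ant w true 0 1
  have h2 := Lt_add d.suc w false 0 (Lt true d.ant 0 1).2
  rw [Nat.zero_add] at h1 h2
  rw [Nat.add_comm 1 w] at h1
  simp only [Ltrans, h1, h2, LSeq.rename_comp, Nat.zero_add]


/-- For every display sequent `δ` and all labels `w, u`: (1) `L_w(δ)` is
a labeled polytree sequent; (2) the length of `L_w(δ)` is at most the length of `δ`;
(3) `L_w(δ)` and `L_u(δ)` are isomorphic. -/
theorem ltrans_properties (d : DSeq) (w u : Nat) :
    IsPolytree (Ltrans d w) ∧ (Ltrans d w).len ≤ d.len ∧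
      LSeq.Iso (Ltrans d w) (Ltrans d u) := by
  refine ⟨?_, ?_, ?_⟩
  · have h := Lt_isRootedTree d.ant true w (w + 1) w.lt_succ_self
    exact (h.comp w.lt_succ_self
      (Lt_isRootedTree d.suc false w _ (w.lt_succ_self.trans_le h.le))).isPolytree
  · exact (LSeq.len_comp_le _ _).trans (Nat.add_le_add (Lt_len_le _ _ _ _) (Lt_len_le _ _ _ _))
  · have h : Ltrans d u = (Ltrans d w).rename (fun a => a - w + u) := by
      rw [Ltrans_eq_rename d w, Ltrans_eq_rename d u, LSeq.rename_rename]
      simp [Function.comp_def]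
    rw [h]
    refine LSeq.iso_rename ?_
    rw [Ltrans_eq_rename d w, LSeq.labels_rename, Finset.coe_image]
    rintro _ ⟨a, _, rfl⟩ _ ⟨b, _, rfl⟩ hab
    simpa using hab
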